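/- For every integer m ≥ 2, every n ∈ ℕ, and every z > 0, the following identity of Brychkov holds: ∑_{k₁+⋯+k_m = n} ∏_{i=1}^{m} (1/kᵢ!) [I_{-kᵢ-1/2}(z) - I_{kᵢ+1/2}(z)] = (-1)ⁿ · (m^{1/2}/n!) · π^{(1-m)/2} · (z/2)^{(1-m)/2 - n} · ∑_{k=0}^{n} C(n,k) · ((m-1)/2)_{n-k} · (-mz/2)^k · [I_{-k-1/2}(mz) - I_{k+1/2}(mz)], where the sum on the left is over all m-tuples (k₁, …, k_m) of nonnegative integers summing to n. -/

import Mathlib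

/-- The modified Bessel function of the first kind,
`I_ν(z) = ∑_{j=0}^∞ (z/2)^{2j+ν} / (j! Γ(j+ν+1))`, where `1/Γ` is interpreted as `0` at
nonpositive integers (in Mathlib, `Real.Gamma` vanishes there and division by zero is zero). -/
noncomputable def besselI (ν z : ℝ) : ℝ :=
  ∑' j : ℕ, (z / 2) ^ (2 * (j : ℝ) + ν) / ((Nat.factorial j : ℝ) * Real.Gamma ((j : ℝ) + ν + 1))

/-- The Pochhammer symbol (rising factorial) `(a)_j = a (a+1) ⋯ (a+j-1)`. -/
noncomputable def poch (a : ℝ) (j : ℕ) : ℝ := ∏ i ∈ Finset.range j, (a + i)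


/-- The general term of the series defining `besselI`. -/
noncomputable def besselITerm (ν z : ℝ) (j : ℕ) : ℝ :=
  (z / 2) ^ (2 * (j : ℝ) + ν) / ((Nat.factorial j : ℝ) * Real.Gamma ((j : ℝ) + ν + 1))

theorem besselI_eq_tsum_besselITerm (ν z : ℝ) : besselI ν z = ∑' j, besselITerm ν z j := rfl

theorem besselITerm_eq_mul (ν z : ℝ) (j : ℕ) :
    besselITerm ν z j =
      (z / 2) ^ (2 * (j : ℝ) + ν) * ((j.factorial : ℝ)⁻¹ * (Real.Gamma (j + ν + 1))⁻¹) := by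
  rw [besselITerm, div_eq_mul_inv, mul_inv]

theorem inv_Gamma_eq_mul_inv_Gamma_add_one (x : ℝ) :
    (Real.Gamma x)⁻¹ = x * (Real.Gamma (x + 1))⁻¹ := by
  rcases eq_or_ne x 0 with rfl | hx
  · simp
  · rw [Real.Gamma_add_one hx, mul_inv, mul_inv_cancel_left₀ hx]

theorem besselITerm_succ_mul (ν : ℝ) {z : ℝ} (hz : 0 < z) (j : ℕ) :
    besselITerm ν z j * (z / 2) ^ 2 =
      besselITerm ν z (j + 1) * ((j + 1) * (j + ν + 1)) := by
  have hpow : (z / 2) ^ (2 * ((j + 1 : ℕ) : ℝ) + ν) =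
      (z / 2) ^ (2 * (j : ℝ) + ν) * (z / 2) ^ 2 := by
    rw [← Real.rpow_natCast (z / 2) 2, ← Real.rpow_add (by positivity)]
    congr 1
    push_cast
    ring
  have hΓ := inv_Gamma_eq_mul_inv_Gamma_add_one (j + ν + 1)
  rw [besselITerm_eq_mul, besselITerm_eq_mul, hpow, Nat.factorial_succ,
    show ((j + 1 : ℕ) : ℝ) + ν + 1 = j + ν + 1 + 1 by push_cast; ring, hΓ]
  push_cast
  field_simp

theorem summable_besselITerm (ν : ℝ) {z : ℝ} (hz : 0 < z) : Summable (besselITerm ν z) := by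
  refine summable_of_ratio_norm_eventually_le (r := 1 / 2) (by norm_num) ?_
  filter_upwards [Filter.eventually_ge_atTop ⌈max (-ν) (2 * (z / 2) ^ 2)⌉₊] with j hj
  have hj' := (Nat.le_ceil _).trans (Nat.cast_le (α := ℝ).2 hj)
  have h₁ : 0 ≤ j + ν := by linarith [(le_max_left _ _).trans hj']
  have h₂ : 2 * (z / 2) ^ 2 ≤ j := (le_max_right _ _).trans hj'
  have h₁' : 0 < j + ν + 1 := by linarith
  have h₃ : 2 * (z / 2) ^ 2 ≤ (j + 1) * (j + ν + 1) := by nlinarith [sq_nonneg z]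
  have h := congrArg norm (besselITerm_succ_mul ν hz j)
  have hz2 : 0 < (z / 2) ^ 2 := by positivity
  rw [norm_mul, norm_mul, Real.norm_of_nonneg hz2.le,
    Real.norm_of_nonneg (show 0 ≤ ((j : ℝ) + 1) * (j + ν + 1) by positivity)] at h
  have h₄ := mul_le_mul_of_nonneg_left h₃ (norm_nonneg (besselITerm ν z (j + 1)))
  rw [← h] at h₄
  nlinarith

theorem besselITerm_sub_one_zero (ν : ℝ) {z : ℝ} (hz : 0 < z) :
    besselITerm (ν - 1) z 0 = 2 * ν / z * besselITerm ν z 0 := by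
  have hΓ := inv_Gamma_eq_mul_inv_Gamma_add_one ν
  simp only [besselITerm_eq_mul, Nat.cast_zero, mul_zero, zero_add, sub_add_cancel, hΓ, Real.rpow_sub_one (half_pos hz).ne']
  field_simp

theorem besselITerm_sub_one_succ (ν : ℝ) {z : ℝ} (hz : 0 < z) (j : ℕ) :
    besselITerm (ν - 1) z (j + 1) =
      besselITerm (ν + 1) z j + 2 * ν / z * besselITerm ν z (j + 1) := by
  have hΓ := inv_Gamma_eq_mul_inv_Gamma_add_one (j + ν + 1)
  have hpow : (z / 2) ^ (2 * ((j + 1 : ℕ) : ℝ) + ν) =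
      (z / 2) ^ (2 * (j : ℝ) + (ν + 1)) * (z / 2) := by
    rw [← Real.rpow_add_one (half_pos hz).ne']
    congr 1
    push_cast
    ring
  have hpow' : (z / 2) ^ (2 * ((j + 1 : ℕ) : ℝ) + (ν - 1)) =
      (z / 2) ^ (2 * (j : ℝ) + (ν + 1)) := by
    congr 1
    push_cast
    ring
  simp only [besselITerm_eq_mul, hpow, hpow', Nat.factorial_succ,
    show ((j + 1 : ℕ) : ℝ) + (ν - 1) + 1 = j + ν + 1 by push_cast; ring,
    show ((j + 1 : ℕ) : ℝ) + ν + 1 = j + ν + 1 + 1 by push_cast; ring,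
    show (j : ℝ) + (ν + 1) + 1 = j + ν + 1 + 1 by ring, hΓ]
  generalize (z / 2) ^ (2 * (j : ℝ) + (ν + 1)) = q
  generalize (Real.Gamma (j + ν + 1 + 1))⁻¹ = g
  push_cast
  field_simp
  ring

theorem besselI_sub_one (ν : ℝ) {z : ℝ} (hz : 0 < z) :
    besselI (ν - 1) z = besselI (ν + 1) z + 2 * ν / z * besselI ν z := by
  simp only [besselI_eq_tsum_besselITerm]
  rw [(summable_besselITerm (ν - 1) hz).tsum_eq_zero_add,
    (summable_besselITerm ν hz).tsum_eq_zero_add, besselITerm_sub_one_zero ν hz]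
  simp only [besselITerm_sub_one_succ ν hz]
  rw [(summable_besselITerm (ν + 1) hz).tsum_add
    (((summable_nat_add_iff 1).2 (summable_besselITerm ν hz)).mul_left _), tsum_mul_left]
  ring

theorem factorial_mul_Gamma_add_half (j : ℕ) :
    (j.factorial : ℝ) * Real.Gamma (j + 1 / 2) = (2 * j).factorial * √Real.pi / 4 ^ j := by
  induction j with
  | zero => simp [-one_div, Real.Gamma_one_half_eq]
  | succ j ih =>
    rw [show ((j + 1 : ℕ) : ℝ) + 1 / 2 = j + 1 / 2 + 1 by push_cast; ring,
      Real.Gamma_add_one (by positivity), show 2 * (j + 1) = 2 * j + 1 + 1 by ring,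
      Nat.factorial_succ, Nat.factorial_succ, Nat.factorial_succ]
    push_cast
    linear_combination ((j : ℝ) + 1) * (j + 1 / 2) * ih

theorem besselI_neg_half {z : ℝ} (hz : 0 < z) :
    besselI (-1 / 2) z = √(2 / (Real.pi * z)) * Real.cosh z := by
  refine HasSum.tsum_eq (((Real.hasSum_cosh z).mul_left _).congr_fun fun j ↦ ?_)
  have hΓ := factorial_mul_Gamma_add_half j
  rw [show (j : ℝ) + -1 / 2 + 1 = j + 1 / 2 by ring, hΓ, Real.rpow_add (half_pos hz),
    show (-1 / 2 : ℝ) = -(1 / 2) by ring, Real.rpow_neg (half_pos hz).le, ← Real.sqrt_eq_rpow,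
    show 2 * (j : ℝ) = ((2 * j : ℕ) : ℝ) by push_cast; ring, Real.rpow_natCast, div_pow,
    pow_mul 2, show 2 / (Real.pi * z) = (z / 2 * Real.pi)⁻¹ by field_simp, Real.sqrt_inv,
    Real.sqrt_mul (half_pos hz).le]
  norm_num
  field_simp

theorem besselI_half {z : ℝ} (hz : 0 < z) :
    besselI (1 / 2) z = √(2 / (Real.pi * z)) * Real.sinh z := by
  refine HasSum.tsum_eq (((Real.hasSum_sinh z).mul_left _).congr_fun fun j ↦ ?_)
  have hΓ := factorial_mul_Gamma_add_half j
  have hs := Real.mul_self_sqrt (half_pos hz).le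
  rw [Real.Gamma_add_one (by positivity), mul_left_comm, hΓ, Real.rpow_add (half_pos hz),
    ← Real.sqrt_eq_rpow, Nat.factorial_succ,
    show 2 * (j : ℝ) = ((2 * j : ℕ) : ℝ) by push_cast; ring, Real.rpow_natCast, div_pow,
    pow_mul 2, show 2 / (Real.pi * z) = (z / 2 * Real.pi)⁻¹ by field_simp, Real.sqrt_inv,
    Real.sqrt_mul (half_pos hz).le, pow_succ z]
  have hpos : 0 < √(z / 2) := Real.sqrt_pos.2 (half_pos hz)
  generalize √(z / 2) = s at *
  rw [show (4 : ℝ) ^ j = (2 ^ 2) ^ j by norm_num]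
  push_cast
  field_simp
  linear_combination 2 * hs

/-- The values `y_{k-1}(1/z)` of the Bessel polynomials, with the index shifted so that the
sequence starts with `y_{-1} = y_0 = 1`. -/
noncomputable def besselPoly (z : ℝ) : ℕ → ℝ
  | 0 => 1
  | 1 => 1
  | k + 2 => besselPoly z k + (2 * k + 1) / z * besselPoly z (k + 1)

theorem besselI_neg_sub_besselI (k : ℕ) {z : ℝ} (hz : 0 < z) :
    besselI (-(k : ℝ) - 1 / 2) z - besselI ((k : ℝ) + 1 / 2) z =
      (-1) ^ k * √(2 / (Real.pi * z)) * Real.exp (-z) * besselPoly z (k + 1) := by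
  have h₀ : besselI (-1 / 2) z - besselI (1 / 2) z = √(2 / (Real.pi * z)) * Real.exp (-z) := by
    rw [besselI_neg_half hz, besselI_half hz, ← Real.cosh_sub_sinh]
    ring
  have hrec (ν : ℝ) : besselI (-(ν + 1)) z - besselI (ν + 1) z =
      besselI (-(ν - 1)) z - besselI (ν - 1) z -
        2 * ν / z * (besselI (-ν) z - besselI ν z) := by
    have h₁ := besselI_sub_one ν hz
    have h₂ := besselI_sub_one (-ν) hz
    rw [show -ν - 1 = -(ν + 1) by ring, show -ν + 1 = -(ν - 1) by ring] at h₂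
    rw [h₁, h₂]
    ring
  induction k using Nat.twoStepInduction with
  | zero =>
    simp only [besselPoly, Nat.cast_zero, neg_zero, zero_sub, zero_add, pow_zero, one_mul, mul_one]
    rw [← h₀, neg_div]
  | one =>
    have h := hrec (1 / 2)
    norm_num [besselPoly] at h h₀ ⊢
    rw [h]
    linear_combination (-1 - 1 / z) * h₀
  | more k ih₀ ih₁ =>
    have h := hrec (k + 1 + 1 / 2)
    rw [show -((k : ℝ) + 1 + 1 / 2 + 1) = -((k + 2 : ℕ) : ℝ) - 1 / 2 by push_cast; ring,
      show (k : ℝ) + 1 + 1 / 2 + 1 = ((k + 2 : ℕ) : ℝ) + 1 / 2 by push_cast; ring,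
      show -((k : ℝ) + 1 + 1 / 2 - 1) = -(k : ℝ) - 1 / 2 by ring,
      show (k : ℝ) + 1 + 1 / 2 - 1 = k + 1 / 2 by ring,
      show -((k : ℝ) + 1 + 1 / 2) = -((k + 1 : ℕ) : ℝ) - 1 / 2 by push_cast; ring,
      show (k : ℝ) + 1 + 1 / 2 = ((k + 1 : ℕ) : ℝ) + 1 / 2 by push_cast; ring, ih₀, ih₁] at h
    rw [h, show besselPoly z (k + 2 + 1) = besselPoly z (k + 1) +
      (2 * (k + 1 : ℕ) + 1) / z * besselPoly z (k + 1 + 1) from rfl]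
    push_cast
    ring

open PowerSeries in
/-- The exponential generating function of the sequence `k ↦ c ^ k * besselPoly (c * z) (k + s)`. -/
noncomputable def besselPolyGen (z c : ℝ) (s : ℕ) : PowerSeries ℝ :=
  PowerSeries.mk fun k ↦ c ^ k * besselPoly (c * z) (k + s) / k.factorial

section PowerSeries

open PowerSeries

theorem derivative_besselPolyGen_zero (z c : ℝ) :
    d⁄dX ℝ (besselPolyGen z c 0) = C c * besselPolyGen z c 1 := by
  ext k
  rw [coeff_derivative, coeff_C_mul, besselPolyGen, besselPolyGen, coeff_mk, coeff_mk,
    Nat.factorial_succ]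
  push_cast
  field_simp
  ring_nf

theorem derivative_besselPolyGen_one {z c : ℝ} (hz : z ≠ 0) (hc : c ≠ 0) :
    (1 - C (2 / z) * X) * d⁄dX ℝ (besselPolyGen z c 1) =
      C (1 / z) * besselPolyGen z c 1 + C c * besselPolyGen z c 0 := by
  ext k
  rw [sub_mul, one_mul, mul_assoc, map_sub, map_add, coeff_C_mul, coeff_C_mul, coeff_C_mul]
  cases k with
  | zero =>
    rw [coeff_derivative]
    simp [besselPolyGen, besselPoly]
    field_simp
    ring
  | succ k =>
    rw [coeff_succ_X_mul, coeff_derivative, coeff_derivative]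
    simp only [besselPolyGen, coeff_mk, Nat.factorial_succ, besselPoly, add_zero]
    push_cast
    field_simp
    ring

theorem sq_besselPolyGen {z c : ℝ} (hz : z ≠ 0) (hc : c ≠ 0) :
    besselPolyGen z c 0 ^ 2 = (1 - C (2 / z) * X) * besselPolyGen z c 1 ^ 2 := by
  apply PowerSeries.derivative.ext
  · have h₀ := derivative_besselPolyGen_zero z c
    have h₁ := derivative_besselPolyGen_one hz hc
    have h2 : (C (2 / z) : PowerSeries ℝ) = 2 * C (1 / z) := by
      rw [← map_ofNat C 2, ← map_mul]; congr 1; ring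
    simp only [pow_two, Derivation.leibniz, smul_eq_mul, map_sub, derivative_C, derivative_X,
      derivative_one, h₀]
    linear_combination (-2) * besselPolyGen z c 1 * h₁ + besselPolyGen z c 1 ^ 2 * h2
  · simp [besselPolyGen, besselPoly]

theorem besselPolyGen_zero_mul_one {z c : ℝ} (hz : z ≠ 0) (hc : c ≠ 0) :
    besselPolyGen z c 0 * besselPolyGen z 1 1 = besselPolyGen z 1 0 * besselPolyGen z c 1 := by
  have h : (besselPolyGen z c 0 * besselPolyGen z 1 1) ^ 2 =
      (besselPolyGen z 1 0 * besselPolyGen z c 1) ^ 2 := by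
    rw [mul_pow, mul_pow, sq_besselPolyGen hz hc, sq_besselPolyGen hz one_ne_zero]
    ring
  refine (sq_eq_sq_iff_eq_or_eq_neg.1 h).resolve_right fun h' ↦ ?_
  have := congrArg constantCoeff h'
  simp [besselPolyGen, besselPoly] at this
  norm_num at this

/-- The binomial series of `(1 - c X) ^ (-b)`. -/
noncomputable def pochSeries (b c : ℝ) : PowerSeries ℝ :=
  PowerSeries.mk fun j ↦ poch b j * c ^ j / j.factorial

theorem derivative_pochSeries (b c : ℝ) :
    (1 - C c * X) * d⁄dX ℝ (pochSeries b c) = C (b * c) * pochSeries b c := by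
  ext k
  rw [sub_mul, one_mul, mul_assoc, map_sub, coeff_C_mul, coeff_C_mul]
  cases k with
  | zero =>
    rw [coeff_derivative]
    simp [pochSeries, poch]
  | succ k =>
    rw [coeff_succ_X_mul, coeff_derivative, coeff_derivative]
    simp only [pochSeries, coeff_mk, Nat.factorial_succ, poch, Finset.prod_range_succ]
    push_cast
    field_simp
    ring

/-- Two power series with constant coefficient `1` and the same logarithmic derivative agree. -/
theorem eq_of_derivative_mul_eq {F H : PowerSeries ℝ} (hF : constantCoeff F = 1)
    (hH : constantCoeff H = 1) (h : d⁄dX ℝ F * H = F * d⁄dX ℝ H) : F = H := by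
  have hH0 : constantCoeff H ≠ 0 := by simp [hH]
  have hi : H * H⁻¹ = 1 := PowerSeries.mul_inv_cancel _ hH0
  have hq : F * H⁻¹ = 1 := by
    apply PowerSeries.derivative.ext
    · rw [Derivation.leibniz, derivative_inv', derivative_one]
      simp only [smul_eq_mul]
      linear_combination H⁻¹ ^ 2 * h - d⁄dX ℝ F * H⁻¹ * hi
    · simp [hF, hH]
  linear_combination H * hq - F * hi

theorem besselPolyGen_pow {z : ℝ} (hz : z ≠ 0) (m : ℕ) :
    besselPolyGen z 1 1 ^ (m + 1) =
      pochSeries (m / 2) (2 / z) * besselPolyGen z ((m + 1 : ℕ) : ℝ) 1 := by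
  have hm : ((m + 1 : ℕ) : ℝ) ≠ 0 := by positivity
  apply eq_of_derivative_mul_eq
  · simp [besselPolyGen, besselPoly]
  · simp [besselPolyGen, besselPoly, pochSeries, poch]
  have h₁ := derivative_besselPolyGen_one hz one_ne_zero
  have hm₁ := derivative_besselPolyGen_one hz hm
  have hB := derivative_pochSeries (m / 2) (2 / z)
  have hx := besselPolyGen_zero_mul_one hz hm
  have hb : (C ((m : ℝ) / 2 * (2 / z)) : PowerSeries ℝ) = m * C (1 / z) := by
    rw [← map_natCast C m, ← map_mul]; congr 1; ring
  have hc : (C (((m + 1 : ℕ) : ℝ)) : PowerSeries ℝ) = m + 1 := by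
    rw [map_natCast]; push_cast; ring
  rw [map_one, one_mul] at h₁
  rw [hb] at hB
  rw [hc] at hm₁
  have hw : (1 - C (2 / z) * X : PowerSeries ℝ) ≠ 0 := by
    intro h
    simpa using congrArg constantCoeff h
  apply mul_left_cancel₀ hw
  rw [derivative_pow, Derivation.leibniz]
  simp only [smul_eq_mul, add_tsub_cancel_right, Nat.cast_add, Nat.cast_one] at *
  generalize besselPolyGen z 1 1 = g at *
  generalize besselPolyGen z (m + 1) 1 = k at *
  generalize pochSeries (m / 2) (2 / z) = B at *
  linear_combination (m + 1) * g ^ m * B * k * h₁ - g ^ (m + 1) * B * hm₁ - g ^ (m + 1) * k * hB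
    - (m + 1) * g ^ m * B * hx

theorem coeff_pow_eq_sum_antidiagonalTuple (f : PowerSeries ℝ) (m n : ℕ) :
    coeff n (f ^ m) = ∑ k ∈ Finset.Nat.antidiagonalTuple m n, ∏ i, coeff (k i) f := by
  have h := coeff_prod (fun _ : Fin m ↦ f) n Finset.univ
  rw [Finset.prod_const, Finset.card_univ, Fintype.card_fin] at h
  rw [h]
  refine Finset.sum_bij (fun l _ ↦ ⇑l) (fun l hl ↦ ?_) (fun _ _ _ _ h ↦ DFunLike.coe_injective h)
    (fun k hk ↦ ⟨Finsupp.equivFunOnFinite.symm k, ?_, ?_⟩) fun _ _ ↦ rfl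
  · simpa [Finset.Nat.mem_antidiagonalTuple] using hl
  · simpa [Finset.Nat.mem_antidiagonalTuple] using hk
  · simp

end PowerSeries

theorem sqrt_two_div_pi_mul_pow (m : ℕ) (hm : 0 < m) {z : ℝ} (hz : 0 < z) :
    √(2 / (Real.pi * z)) ^ m =
      √m * Real.pi ^ ((1 - (m : ℝ)) / 2) * (z / 2) ^ ((1 - (m : ℝ)) / 2) *
        √(2 / (Real.pi * (m * z))) := by
  have hm' : (0 : ℝ) < m := Nat.cast_pos.2 hm
  have hpi := Real.pi_pos
  have hx : 0 < Real.pi * (z / 2) := by positivity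
  have h₁ : 2 / (Real.pi * z) = (Real.pi * (z / 2))⁻¹ := by field_simp
  have h₂ : √(2 / (Real.pi * (m * z))) = (√m)⁻¹ * √(2 / (Real.pi * z)) := by
    rw [← Real.sqrt_inv, ← Real.sqrt_mul (by positivity)]
    congr 1
    field_simp
  have h₃ : √(2 / (Real.pi * z)) = (Real.pi * (z / 2)) ^ (-(1 / 2) : ℝ) := by
    rw [h₁, Real.sqrt_inv, Real.sqrt_eq_rpow, Real.rpow_neg hx.le]
  rw [h₂, mul_assoc (√m), ← Real.mul_rpow hpi.le (by positivity), h₃, ← Real.rpow_natCast,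
    ← Real.rpow_mul hx.le, show √m * (Real.pi * (z / 2)) ^ ((1 - (m : ℝ)) / 2) *
      ((√m)⁻¹ * (Real.pi * (z / 2)) ^ (-(1 / 2) : ℝ)) =
      (√m * (√m)⁻¹) * ((Real.pi * (z / 2)) ^ ((1 - (m : ℝ)) / 2) *
      (Real.pi * (z / 2)) ^ (-(1 / 2) : ℝ)) by ring,
    mul_inv_cancel₀ (Real.sqrt_pos.2 hm').ne', one_mul, ← Real.rpow_add hx]
  congr 1
  ring

theorem stmt_19 (m : ℕ) (hm : 2 ≤ m) (n : ℕ) (z : ℝ) (hz : 0 < z) :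
    ∑ k ∈ Finset.Nat.antidiagonalTuple m n,
      ∏ i, (1 / (Nat.factorial (k i) : ℝ)) *
        (besselI (-(k i : ℝ) - 1 / 2) z - besselI ((k i : ℝ) + 1 / 2) z) =
    (-1 : ℝ) ^ n * (Real.sqrt m / (Nat.factorial n : ℝ)) *
      Real.pi ^ ((1 - (m : ℝ)) / 2) * (z / 2) ^ ((1 - (m : ℝ)) / 2 - n) *
      ∑ k ∈ Finset.range (n + 1),
        (n.choose k : ℝ) * poch (((m : ℝ) - 1) / 2) (n - k) * (-(m * z) / 2) ^ k *
          (besselI (-(k : ℝ) - 1 / 2) (m * z) - besselI ((k : ℝ) + 1 / 2) (m * z)) := by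
  have hm0 : 0 < m := by omega
  have hmz : 0 < m * z := mul_pos (Nat.cast_pos.2 hm0) hz
  have hlhs : ∀ k ∈ Finset.Nat.antidiagonalTuple m n,
      ∏ i, (1 / (Nat.factorial (k i) : ℝ)) *
        (besselI (-(k i : ℝ) - 1 / 2) z - besselI ((k i : ℝ) + 1 / 2) z) =
      (-1) ^ n * (√(2 / (Real.pi * z)) * Real.exp (-z)) ^ m *
        ∏ i, PowerSeries.coeff (k i) (besselPolyGen z 1 1) := by
    intro k hk
    rw [← Finset.Nat.mem_antidiagonalTuple.1 hk, ← Finset.prod_pow_eq_pow_sum,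
      ← Fin.prod_const m,
      ← Finset.prod_mul_distrib, ← Finset.prod_mul_distrib]
    refine Finset.prod_congr rfl fun i _ ↦ ?_
    rw [besselI_neg_sub_besselI _ hz, besselPolyGen, PowerSeries.coeff_mk, one_mul, one_pow]
    ring
  have hexp : Real.exp (-z) ^ m = Real.exp (-(m * z)) := by
    rw [← Real.exp_nat_mul, mul_neg]
  have hgen : besselPolyGen z 1 1 ^ m =
      pochSeries (((m : ℝ) - 1) / 2) (2 / z) * besselPolyGen z m 1 := by
    obtain ⟨m, rfl⟩ : ∃ l, m = l + 1 := ⟨m - 1, by omega⟩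
    rw [besselPolyGen_pow hz.ne', Nat.cast_add_one, add_sub_cancel_right]
  rw [Finset.sum_congr rfl hlhs, ← Finset.mul_sum, ← coeff_pow_eq_sum_antidiagonalTuple, mul_pow,
    hexp, sqrt_two_div_pi_mul_pow m hm0 hz, hgen, mul_comm (pochSeries _ _),
    PowerSeries.coeff_mul, Finset.Nat.sum_antidiagonal_eq_sum_range_succ_mk, Finset.mul_sum,
    Finset.mul_sum]
  refine Finset.sum_congr rfl fun k hk ↦ ?_
  obtain ⟨j, rfl⟩ := Nat.exists_eq_add_of_le (Nat.lt_succ_iff.1 (Finset.mem_range.1 hk))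
  rw [besselI_neg_sub_besselI _ hmz, Real.rpow_sub_natCast (half_pos hz).ne', besselPolyGen,
    pochSeries, PowerSeries.coeff_mk, PowerSeries.coeff_mk, Nat.add_sub_cancel_left,
    Nat.cast_add_choose, neg_div, neg_pow (m * z / 2)]
  have hsign : ((-1 : ℝ) ^ k) * (-1) ^ k = 1 := by rw [← mul_pow]; norm_num
  have hfact : ((k + j).factorial : ℝ) ≠ 0 := by positivity
  dsimp only
  generalize √(2 / (Real.pi * (m * z))) = r
  generalize Real.pi ^ ((1 - (m : ℝ)) / 2) = p
  generalize (z / 2) ^ ((1 - (m : ℝ)) / 2) = q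
  generalize √(m : ℝ) = t
  rw [show (m * z / 2) ^ k = (m : ℝ) ^ k * (z / 2) ^ k by rw [← mul_pow, mul_div_assoc],
    show (2 / z) ^ j = ((z / 2) ^ j)⁻¹ by rw [← inv_pow, inv_div], pow_add (z / 2)]
  have hzk : (z / 2) ^ k ≠ 0 := by positivity
  have hzj : (z / 2) ^ j ≠ 0 := by positivity
  generalize (z / 2) ^ k = u at *
  generalize (z / 2) ^ j = v at *
  field_simp
  linear_combination
    (-t * p * q * r * besselPoly (m * z) (k + 1) * poch (((m : ℝ) - 1) / 2) j) * hsign
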